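/- arXiv:1808.09248 — 3 statements merged into one kernel-verified Lean document; each statement's English description precedes it below -/
import Mathlib

section
/- Let α, β, γ be the three distinct complex roots of x³ - x² - x - 1 = 0. Then for every integer n, (K(n) : ℂ) = α^n + β^n + γ^n (Binet formula for Tribonacci-Lucas numbers, valid for negative indices as well). -/
/-- Two-sided sequences satisfying the Tribonacci recurrence are determined by their values at
`0`, `1` and `2`. -/
theorem tribonacci_recurrence_unique {G : Type*} [AddCommGroup G] {u v : ℤ → G}
    (hu : ∀ n, u n = u (n - 1) + u (n - 2) + u (n - 3))
    (hv : ∀ n, v n = v (n - 1) + v (n - 2) + v (n - 3))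
    (h0 : u 0 = v 0) (h1 : u 1 = v 1) (h2 : u 2 = v 2) (n : ℤ) : u n = v n := by
  suffices h : u n = v n ∧ u (n + 1) = v (n + 1) ∧ u (n + 2) = v (n + 2) from h.1
  induction n using Int.induction_on with
  | zero => exact ⟨h0, by simpa using h1, by simpa using h2⟩
  | succ k ih =>
    obtain ⟨ha, hb, hc⟩ := ih
    have hu' := hu (k + 3)
    have hv' := hv (k + 3)
    ring_nf at *
    exact ⟨hb, hc, by rw [hu', hv', ha, hb, hc]⟩
  | pred k ih =>
    obtain ⟨ha, hb, hc⟩ := ih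
    have hu' := hu (-k + 2)
    have hv' := hv (-k + 2)
    ring_nf at *
    refine ⟨?_, ha, hb⟩
    rw [hc, hv', ha, hb] at hu'
    exact (add_left_cancel hu').symm

/-- The integer powers of a root of `x³ - x² - x - 1` satisfy the Tribonacci recurrence. -/
theorem zpow_tribonacci_recurrence {F : Type*} [Field F] {x : F}
    (hx : x ^ 3 - x ^ 2 - x - 1 = 0) (n : ℤ) :
    x ^ n = x ^ (n - 1) + x ^ (n - 2) + x ^ (n - 3) := by
  have hx0 : x ≠ 0 := by
    rintro rfl
    simp at hx
  obtain ⟨m, rfl⟩ : ∃ m, n = m + 3 := ⟨n - 3, by ring⟩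
  rw [show m + 3 - 1 = m + 2 by ring, show m + 3 - 2 = m + 1 by ring,
    show m + 3 - 3 = m by ring, zpow_add₀ hx0, zpow_add₀ hx0, zpow_add₀ hx0]
  norm_cast
  linear_combination x ^ m * hx


/-- Binet formula for the Tribonacci-Lucas numbers, valid for all integer indices. -/
theorem tribonacci_lucas_binet (K : ℤ → ℤ) (hK0 : K 0 = 3) (hK1 : K 1 = 1) (hK2 : K 2 = 3)
    (hKrec : ∀ n : ℤ, K n = K (n - 1) + K (n - 2) + K (n - 3))
    (α β γ : ℂ) (hαβ : α ≠ β) (hαγ : α ≠ γ) (hβγ : β ≠ γ)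
    (hroots : ∀ x : ℂ, (x - α) * (x - β) * (x - γ) = x ^ 3 - x ^ 2 - x - 1)
    (n : ℤ) :
    (K n : ℂ) = α ^ n + β ^ n + γ ^ n := by
  have h0 := hroots 0
  have h1 := hroots 1
  have h2 := hroots (-1)
  have he1 : α + β + γ = 1 := by linear_combination -(h1 + h2) / 2 + h0
  have he2 : α * β + α * γ + β * γ = -1 := by linear_combination (h1 - h2) / 2
  have hα := zpow_tribonacci_recurrence ((hroots α).symm.trans (by ring))
  have hβ := zpow_tribonacci_recurrence ((hroots β).symm.trans (by ring))
  have hγ := zpow_tribonacci_recurrence ((hroots γ).symm.trans (by ring))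
  refine tribonacci_recurrence_unique (u := fun n ↦ (K n : ℂ))
    (v := fun n ↦ α ^ n + β ^ n + γ ^ n) (fun n ↦ ?_) (fun n ↦ ?_) ?_ ?_ ?_ n
  · exact_mod_cast hKrec n
  · linear_combination hα n + hβ n + hγ n
  · norm_num [hK0]
  · simp [hK1, he1]
  · simp only [hK2]
    norm_cast
    linear_combination -(α + β + γ + 1) * he1 + 2 * he2
end

section
/- Let α, β, γ be the three distinct complex roots of x³ - x² - x - 1 = 0. Then for all integers n and s, (K(n+s) : ℂ) = ((α² - α)·K(s) + α·K(s+1) + K(s-1))·αⁿ/((α-γ)(α-β)) + ((β² - β)·K(s) + β·K(s+1) + K(s-1))·βⁿ/((β-γ)(β-α)) + ((γ² - γ)·K(s) + γ·K(s+1) + K(s-1))·γⁿ/((γ-β)(γ-α)). (This is the componentwise content of the alternative Binet formula for the Tribonacci-Lucas sedenions obtained from their generating function.) -/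
/-- Two bi-infinite sequences satisfying the Tribonacci recurrence agree everywhere as soon as
they agree at `0`, `1` and `2`. -/
theorem tribonacci_recurrence_ext {R : Type*} [AddCommGroup R] {f g : ℤ → R}
    (hf : ∀ n, f (n + 3) = f (n + 2) + f (n + 1) + f n)
    (hg : ∀ n, g (n + 3) = g (n + 2) + g (n + 1) + g n)
    (h0 : f 0 = g 0) (h1 : f 1 = g 1) (h2 : f 2 = g 2) (n : ℤ) : f n = g n := by
  suffices h : ∀ n : ℤ, f n = g n ∧ f (n + 1) = g (n + 1) ∧ f (n + 2) = g (n + 2) from (h n).1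
  intro n
  induction n using Int.induction_on with
  | zero => exact ⟨h0, h1, h2⟩
  | succ k ih =>
    obtain ⟨ih0, ih1, ih2⟩ := ih
    rw [show (k : ℤ) + 1 + 1 = k + 2 by ring, show (k : ℤ) + 1 + 2 = k + 3 by ring]
    exact ⟨ih1, ih2, (hf k).trans (by rw [ih0, ih1, ih2, ← hg])⟩
  | pred k ih =>
    obtain ⟨ih0, ih1, ih2⟩ := ih
    have hf' := hf (-k - 1)
    have hg' := hg (-k - 1)
    rw [show -(k : ℤ) - 1 + 3 = -k + 2 by ring, show -(k : ℤ) - 1 + 2 = -k + 1 by ring,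
      show -(k : ℤ) - 1 + 1 = -k by ring] at *
    refine ⟨?_, ih0, ih1⟩
    rw [hf', hg', ih0, ih1] at ih2
    exact add_left_cancel ih2

/-- The Lagrange interpolation identities for the first three powers at three distinct nodes. -/
theorem sum_pow_div_sub_mul_sub {F : Type*} [Field F] {a b c : F}
    (hab : a ≠ b) (hac : a ≠ c) (hbc : b ≠ c) :
    1 / ((a - c) * (a - b)) + 1 / ((b - c) * (b - a)) + 1 / ((c - b) * (c - a)) = 0 ∧
    a / ((a - c) * (a - b)) + b / ((b - c) * (b - a)) + c / ((c - b) * (c - a)) = 0 ∧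
    a ^ 2 / ((a - c) * (a - b)) + b ^ 2 / ((b - c) * (b - a)) + c ^ 2 / ((c - b) * (c - a)) = 1 := by
  have hab' := sub_ne_zero.2 hab
  have hac' := sub_ne_zero.2 hac
  have hbc' := sub_ne_zero.2 hbc
  rw [← neg_sub a b, ← neg_sub a c, ← neg_sub b c]
  refine ⟨?_, ?_, ?_⟩ <;> field_simp <;> ring

theorem zpow_add_three_of_cube_eq {F : Type*} [Field F] {x : F} (hx : x ^ 3 = x ^ 2 + x + 1)
    (n : ℤ) : x ^ (n + 3) = x ^ (n + 2) + x ^ (n + 1) + x ^ n := by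
  have hx0 : x ≠ 0 := by rintro rfl; simp at hx
  rw [zpow_add₀ hx0, zpow_add₀ hx0, zpow_add₀ hx0, zpow_one]
  norm_cast
  rw [hx]
  ring


/-- Alternative Binet formula for shifted Tribonacci-Lucas numbers. -/
theorem tribonacci_lucas_alt_binet (K : ℤ → ℤ) (hK0 : K 0 = 3) (hK1 : K 1 = 1) (hK2 : K 2 = 3)
    (hKrec : ∀ n : ℤ, K n = K (n - 1) + K (n - 2) + K (n - 3))
    (α β γ : ℂ) (hαβ : α ≠ β) (hαγ : α ≠ γ) (hβγ : β ≠ γ)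
    (hroots : ∀ x : ℂ, (x - α) * (x - β) * (x - γ) = x ^ 3 - x ^ 2 - x - 1)
    (n s : ℤ) :
    (K (n + s) : ℂ)
      = ((α ^ 2 - α) * (K s : ℂ) + α * (K (s + 1) : ℂ) + (K (s - 1) : ℂ)) * α ^ n
          / ((α - γ) * (α - β))
        + ((β ^ 2 - β) * (K s : ℂ) + β * (K (s + 1) : ℂ) + (K (s - 1) : ℂ)) * β ^ n
          / ((β - γ) * (β - α))
        + ((γ ^ 2 - γ) * (K s : ℂ) + γ * (K (s + 1) : ℂ) + (K (s - 1) : ℂ)) * γ ^ n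
          / ((γ - β) * (γ - α)) := by
  have hα : α ^ 3 = α ^ 2 + α + 1 := by linear_combination -hroots α
  have hβ : β ^ 3 = β ^ 2 + β + 1 := by linear_combination -hroots β
  have hγ : γ ^ 3 = γ ^ 2 + γ + 1 := by linear_combination -hroots γ
  obtain ⟨h0, h1, h2⟩ := sum_pow_div_sub_mul_sub hαβ hαγ hβγ
  simp only [div_eq_mul_inv, one_mul] at h0 h1 h2 ⊢
  generalize ((α - γ) * (α - β))⁻¹ = a at *
  generalize ((β - γ) * (β - α))⁻¹ = b at *
  generalize ((γ - β) * (γ - α))⁻¹ = c at *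
  refine tribonacci_recurrence_ext (f := fun n => (K (n + s) : ℂ))
    (g := fun n => ((α ^ 2 - α) * (K s : ℂ) + α * (K (s + 1) : ℂ) + (K (s - 1) : ℂ)) * α ^ n * a
        + ((β ^ 2 - β) * (K s : ℂ) + β * (K (s + 1) : ℂ) + (K (s - 1) : ℂ)) * β ^ n * b
        + ((γ ^ 2 - γ) * (K s : ℂ) + γ * (K (s + 1) : ℂ) + (K (s - 1) : ℂ)) * γ ^ n * c)
    (fun m => ?_) (fun m => ?_) ?_ ?_ ?_ n
  · have h := hKrec (m + 3 + s)
    rw [show m + 3 + s - 1 = m + 2 + s by ring, show m + 3 + s - 2 = m + 1 + s by ring,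
      show m + 3 + s - 3 = m + s by ring] at h
    exact_mod_cast h
  · simp only [zpow_add_three_of_cube_eq hα, zpow_add_three_of_cube_eq hβ,
      zpow_add_three_of_cube_eq hγ]
    ring
  · simp only [zero_add, zpow_zero]
    linear_combination (K s : ℂ) * (h1 - h2) - K (s + 1) * h1 - K (s - 1) * h0
  · simp only [zpow_one, add_comm 1 s]
    linear_combination (-K s : ℂ) * (h1 + h0) - K (s + 1) * h2 - K (s - 1) * h1
      - K s * (a * hα + b * hβ + c * hγ)
  · have h := hKrec (2 + s)
    rw [show 2 + s - 1 = s + 1 by ring, show 2 + s - 2 = s by ring,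
      show 2 + s - 3 = s - 1 by ring] at h
    simp only [h, Int.cast_add]
    norm_cast
    push_cast
    linear_combination (-K s : ℂ) * (h2 + h1) - K (s + 1) * (h2 + h1 + h0) - K (s - 1) * h2
      - K s * (a * α * hα + b * β * hβ + c * γ * hγ) - K (s + 1) * (a * hα + b * hβ + c * hγ)
end

section
/- Let α, β, γ be the three distinct complex roots of x³ - x² - x - 1 = 0. Then for every natural number n, ∑_{i=0}^{n} C(n,i)·T(i) = α·(1+α)ⁿ/((α-β)(α-γ)) + β·(1+β)ⁿ/((β-α)(β-γ)) + γ·(1+γ)ⁿ/((γ-α)(γ-β)), where C(n,i) is the binomial coefficient and the sum is taken in ℂ. -/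
/-- Binet's formula for the Tribonacci numbers. -/
theorem tribonacci_binet (T : ℤ → ℤ) (hT0 : T 0 = 0) (hT1 : T 1 = 1) (hT2 : T 2 = 1)
    (hTrec : ∀ n : ℤ, T n = T (n - 1) + T (n - 2) + T (n - 3))
    (α β γ : ℂ) (hαβ : α ≠ β) (hαγ : α ≠ γ) (hβγ : β ≠ γ)
    (hroots : ∀ x : ℂ, (x - α) * (x - β) * (x - γ) = x ^ 3 - x ^ 2 - x - 1) (n : ℕ) :
    (T n : ℂ) = α * α ^ n / ((α - β) * (α - γ)) + β * β ^ n / ((β - α) * (β - γ))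
      + γ * γ ^ n / ((γ - α) * (γ - β)) := by
  have h₁ := sub_ne_zero.mpr hαβ
  have h₂ := sub_ne_zero.mpr hαγ
  have h₃ := sub_ne_zero.mpr hβγ
  have h₄ := sub_ne_zero.mpr hαβ.symm
  have h₅ := sub_ne_zero.mpr hαγ.symm
  have h₆ := sub_ne_zero.mpr hβγ.symm
  have hsum : α + β + γ = 1 := by
    linear_combination (-1 / 2 : ℂ) * hroots 1 - (1 / 2 : ℂ) * hroots (-1) + hroots 0
  have hα : α ^ 3 = α ^ 2 + α + 1 := by linear_combination -hroots α
  have hβ : β ^ 3 = β ^ 2 + β + 1 := by linear_combination -hroots β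
  have hγ : γ ^ 3 = γ ^ 2 + γ + 1 := by linear_combination -hroots γ
  have e₁ : (β - α) * (β - γ) = -((α - β) * (β - γ)) := by ring
  have e₂ : (γ - α) * (γ - β) = (α - γ) * (β - γ) := by ring
  induction n using Nat.strong_induction_on with
  | _ n ih =>
    match n with
    | 0 =>
      rw [e₁, e₂]
      simp only [Nat.cast_zero, hT0, Int.cast_zero]
      field_simp
      ring
    | 1 =>
      rw [e₁, e₂]
      simp only [Nat.cast_one, hT1, Int.cast_one]
      field_simp
      ring
    | 2 =>
      rw [e₁, e₂]
      simp only [Nat.cast_ofNat, hT2, Int.cast_one]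
      rw [← hsum]
      field_simp
      ring
    | m + 3 =>
      have hrec : T ((m + 3 : ℕ) : ℤ) = T ((m + 2 : ℕ) : ℤ) + T ((m + 1 : ℕ) : ℤ) + T (m : ℤ) := by
        have h := hTrec ((m + 3 : ℕ) : ℤ)
        rwa [show ((m + 3 : ℕ) : ℤ) - 1 = (m + 2 : ℕ) by omega,
          show ((m + 3 : ℕ) : ℤ) - 2 = (m + 1 : ℕ) by omega,
          show ((m + 3 : ℕ) : ℤ) - 3 = m by omega] at h
      rw [hrec, Int.cast_add, Int.cast_add, ih (m + 2) (by omega), ih (m + 1) (by omega), ih m (by omega)]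
      simp only [pow_add, hα, hβ, hγ]
      ring

/-- Binomial sum of Tribonacci numbers:
∑_{i=0}^{n} C(n,i)·T(i) = α(1+α)ⁿ/((α-β)(α-γ)) + β(1+β)ⁿ/((β-α)(β-γ)) + γ(1+γ)ⁿ/((γ-α)(γ-β)). -/
theorem tribonacci_binomial_sum (T : ℤ → ℤ) (hT0 : T 0 = 0) (hT1 : T 1 = 1) (hT2 : T 2 = 1)
    (hTrec : ∀ n : ℤ, T n = T (n - 1) + T (n - 2) + T (n - 3))
    (α β γ : ℂ) (hαβ : α ≠ β) (hαγ : α ≠ γ) (hβγ : β ≠ γ)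
    (hroots : ∀ x : ℂ, (x - α) * (x - β) * (x - γ) = x ^ 3 - x ^ 2 - x - 1)
    (n : ℕ) :
    (∑ i ∈ Finset.range (n + 1), (n.choose i : ℂ) * (T i : ℂ))
      = α * (1 + α) ^ n / ((α - β) * (α - γ))
        + β * (1 + β) ^ n / ((β - α) * (β - γ))
        + γ * (1 + γ) ^ n / ((γ - α) * (γ - β)) := by
  have hbinom (x : ℂ) :
      ∑ i ∈ Finset.range (n + 1), (n.choose i : ℂ) * x ^ i = (1 + x) ^ n := by
    rw [add_comm 1 x, add_pow]
    exact Finset.sum_congr rfl fun i _ => by ring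
  simp only [tribonacci_binet T hT0 hT1 hT2 hTrec α β γ hαβ hαγ hβγ hroots, ← hbinom,
    Finset.mul_sum, Finset.sum_div, ← Finset.sum_add_distrib]
  exact Finset.sum_congr rfl fun i _ => by ring
end
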